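/- arXiv:1910.06184 — 2 statements merged into one kernel-verified Lean document; each statement's English description precedes it below -/
import Mathlib

section
/- Suppose i = i^⋆ and every admissible pairing on the simple A_β-module S_i is skew-Hermitian (i.e. ⟨v,u⟩ = −σ⟨u,v⟩ for all admissible ⟨·,·⟩). Then the division algebra D_i = End_{A_β}(S_i)^{opp} is commutative (D_i = L_i), the involution σ_c restricts to the identity on L_i, and σ ≠ id_F. -/
/-- A pairing `B : S × S → F` is *admissible* (w.r.t. `ζ, σ, c` and the semilinear
operator `θS`) if it is `F`-linear in the first variable, `(F,σ)`-semilinear in the second,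
and satisfies `B(θ u, θ v) = c·ζ(B(u,v))`. -/
def IsAdmissiblePairing {F S : Type*} [Field F] [AddCommGroup S] [Module F S]
    (ζ σ : F → F) (c : F) (θS : S → S) (B : S → S → F) : Prop :=
  (∀ u u' v, B (u + u') v = B u v + B u' v) ∧
  (∀ (a : F) (u v), B (a • u) v = a * B u v) ∧
  (∀ u v v', B u (v + v') = B u v + B u v') ∧
  (∀ (a : F) (u v), B u (a • v) = σ a * B u v) ∧
  (∀ u v, B (θS u) (θS v) = c * ζ (B u v))

section helpers

variable {k F S : Type*} [Field k] [Field F] [Algebra k F] [AddCommGroup S] [Module F S]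

theorem norm_cyclic [FiniteDimensional k F] [IsGalois k F] (ζ : F ≃ₐ[k] F)
    (hgen : ∀ g : F ≃ₐ[k] F, g ∈ Subgroup.zpowers ζ) (c : F) :
    algebraMap k F (Algebra.norm k c) = ∏ j ∈ Finset.range (orderOf ζ), (ζ ^ j) c := by
  classical
  rw [Algebra.norm_eq_prod_automorphisms, ← IsCyclic.image_range_orderOf hgen,
    Finset.prod_image]
  intro i hi j hj h
  exact pow_injOn_Iio_orderOf (by simpa using hi) (by simpa using hj) h

theorem prodStep (ζ : F ≃ₐ[k] F) (c : F) (i : ℕ) :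
    ∏ j ∈ Finset.range (i + 1), (ζ ^ j) c = c * ζ (∏ j ∈ Finset.range i, (ζ ^ j) c) := by
  rw [Finset.prod_range_succ', map_prod, mul_comm]
  simp [pow_succ']

theorem iter_add (θS : S → S) (haddS : ∀ u v, θS (u + v) = θS u + θS v) (i : ℕ) (u v : S) :
    θS^[i] (u + v) = θS^[i] u + θS^[i] v := by
  induction i with
  | zero => rfl
  | succ i ih => simp only [Function.iterate_succ_apply', ih, haddS]

theorem iter_smul (ζ : F ≃ₐ[k] F) (θS : S → S)
    (hsemiS : ∀ (a : F) (u : S), θS (a • u) = ζ a • θS u) (i : ℕ) (a : F) (u : S) :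
    θS^[i] (a • u) = (ζ ^ i) a • θS^[i] u := by
  induction i with
  | zero => simp
  | succ i ih => simp only [Function.iterate_succ_apply', ih, hsemiS, pow_succ', AlgEquiv.mul_apply]

theorem iter_pair (ζ : F ≃ₐ[k] F) (c : F) (θS : S → S) (B : S → S → F)
    (hB : ∀ u v, B (θS u) (θS v) = c * ζ (B u v)) (i : ℕ) (u v : S) :
    B (θS^[i] u) (θS^[i] v) = (∏ j ∈ Finset.range i, (ζ ^ j) c) * (ζ ^ i) (B u v) := by
  induction i with
  | zero => simp
  | succ i ih =>
    rw [Function.iterate_succ_apply', Function.iterate_succ_apply', hB, ih, prodStep, map_mul,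
      pow_succ', AlgEquiv.mul_apply]
    ring

/-- symmetric bilinear -/
def SymBil (B : S → S → F) : Prop :=
  (∀ u u' v, B (u + u') v = B u v + B u' v) ∧ (∀ (a : F) (u v), B (a • u) v = a * B u v) ∧
  (∀ u v, B u v = B v u)

/-- the twisted action on forms -/
def Tw (ζ : F ≃ₐ[k] F) (c : F) (τ : S → S) (B : S → S → F) : S → S → F :=
  fun u v => c * ζ (B (τ u) (τ v))

theorem symBil_Tw (ζ : F ≃ₐ[k] F) (c : F) (τ : S → S)
    (hadd : ∀ u v, τ (u + v) = τ u + τ v)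
    (hsemi : ∀ (a : F) (u : S), τ (a • u) = ζ.symm a • τ u) (B : S → S → F) (hB : SymBil B) :
    SymBil (Tw ζ c τ B) := by
  obtain ⟨h1, h2, h3⟩ := hB
  refine ⟨fun u u' v => ?_, fun a u v => ?_, fun u v => ?_⟩
  · simp only [Tw, hadd, h1, map_add]; ring
  · simp only [Tw, hsemi, h2, map_mul, AlgEquiv.apply_symm_apply]; ring
  · simp only [Tw, h3 (τ u) (τ v)]

theorem exists_form (b : S → S) (N : F) (hN : N ≠ 0) [Nontrivial S]
    (hadd : ∀ u v, b (u + v) = b u + b v) (hsm : ∀ (a : F) u, b (a • u) = a • b u)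
    (hb2 : ∀ u, b (b u) = N • u) (h2 : (2 : F) ≠ 0) :
    ∃ B : S → S → F, SymBil B ∧ (∀ u v, B (b u) v = B u (b v)) ∧ ∃ u v, B u v ≠ 0 := by
  obtain ⟨u, hu⟩ := exists_ne (0 : S)
  obtain ⟨φ, hφ⟩ : ∃ φ : Module.Dual F S, φ u ≠ 0 := by
    by_contra! h
    exact hu ((Module.forall_dual_apply_eq_zero_iff F u).1 h)
  refine ⟨fun x y => φ (b x) * φ y + φ x * φ (b y), ⟨?_, ?_, ?_⟩, ?_, ?_⟩
  · intro u u' v; simp only [hadd, map_add]; ring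
  · intro a u v; simp only [hsm, map_smul, smul_eq_mul]; ring
  · intro u v; ring
  · intro u v; simp only [hb2, map_smul, smul_eq_mul]; ring
  · by_cases h : φ (b u) = 0
    · refine ⟨b u, u, ?_⟩
      simp only [hb2, map_smul, smul_eq_mul, h]
      simpa using ⟨hN, hφ⟩
    · refine ⟨u, u, ?_⟩
      have : φ (b u) * φ u + φ u * φ (b u) = 2 * (φ (b u) * φ u) := by ring
      simp only [this]
      exact mul_ne_zero h2 (mul_ne_zero h hφ)

theorem exists_sym_admissible (ζ : F ≃ₐ[k] F) (n : ℕ) (hn : 0 < n) (hord : orderOf ζ = n)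
    (c : F) (hc : c ≠ 0) [Nontrivial S] (h2 : (2 : F) ≠ 0)
    (θS : S → S)
    (haddS : ∀ u v, θS (u + v) = θS u + θS v)
    (hsemiS : ∀ (a : F) (u : S), θS (a • u) = ζ a • θS u)
    (hbijS : Function.Bijective θS)
    (hb2 : ∀ s, θS^[n] (θS^[n] s) = (∏ j ∈ Finset.range n, (ζ ^ j) c) • s) :
    ∃ B : S → S → F, SymBil B ∧ (∀ u v, B (θS u) (θS v) = c * ζ (B u v)) ∧
      ∃ u v, B u v ≠ 0 := by
  have hζn : ζ ^ n = 1 := hord ▸ pow_orderOf_eq_one ζ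
  set N := ∏ j ∈ Finset.range n, (ζ ^ j) c with hNdef
  have hN : N ≠ 0 := Finset.prod_ne_zero_iff.2 fun j _ =>
    (map_ne_zero_iff (ζ ^ j) (ζ ^ j).injective).2 hc
  have hbsm : ∀ (a : F) (u : S), θS^[n] (a • u) = a • θS^[n] u := by
    intro a u; rw [iter_smul ζ θS hsemiS, hζn]; rfl
  obtain ⟨B, hB, hBsa, u0, v0, hB0⟩ := exists_form (θS^[n]) N hN
    (iter_add θS haddS n) hbsm hb2 h2
  let E := Equiv.ofBijective θS hbijS
  have hE : ∀ u, E u = θS u := fun u => rfl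
  have hEs : ∀ u, E.symm (θS u) = u := fun u => E.symm_apply_apply u
  have hτadd : ∀ u v, E.symm (u + v) = E.symm u + E.symm v := by
    intro u v
    apply E.injective
    rw [hE (E.symm u + E.symm v), haddS, ← hE, ← hE]; simp
  have hτsm : ∀ (a : F) (u : S), E.symm (a • u) = ζ.symm a • E.symm u := by
    intro a u
    apply E.injective
    rw [hE (ζ.symm a • E.symm u), hsemiS, ← hE]; simp
  let T : (S → S → F) → (S → S → F) := Tw ζ c E.symm
  have hT : ∀ C u v, T C (θS u) (θS v) = c * ζ (C u v) := by
    intro C u v; simp only [T, Tw, hEs]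
  have hTi : ∀ i C u v, (T^[i] C) (θS^[i] u) (θS^[i] v)
      = (∏ j ∈ Finset.range i, (ζ ^ j) c) * (ζ ^ i) (C u v) := by
    intro i C
    induction i with
    | zero => simp
    | succ i ih =>
      intro u v
      rw [Function.iterate_succ_apply' T, Function.iterate_succ_apply' θS,
        Function.iterate_succ_apply' θS, hT, ih, prodStep, map_mul,
        pow_succ', AlgEquiv.mul_apply]
      ring
  have hsurj : Function.Surjective (θS^[n]) := hbijS.surjective.iterate n
  have hTn : ∀ C, SymBil C → (∀ u v, C (θS^[n] u) v = C u (θS^[n] v)) → T^[n] C = C := by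
    intro C hC hCsa
    funext x y
    obtain ⟨u, rfl⟩ := hsurj x
    obtain ⟨v, rfl⟩ := hsurj y
    rw [hTi, hζn, ← hCsa, hb2, hC.2.1]; rfl
  have hTf : ∀ (i : ℕ) (f : F) (C : S → S → F) u v,
      (T^[i] (fun u v => f * C u v)) u v = (ζ ^ i) f * (T^[i] C) u v := by
    intro i f C
    induction i with
    | zero => simp
    | succ i ih =>
      intro u v
      rw [Function.iterate_succ_apply' T, Function.iterate_succ_apply' T]
      simp only [T, Tw] at ih ⊢
      rw [ih, map_mul, pow_succ', AlgEquiv.mul_apply]; ring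
  obtain ⟨f, hf⟩ : ∃ f : F, ∑ i ∈ Finset.range n, (ζ ^ i) f * (T^[i] B) u0 v0 ≠ 0 := by
    by_contra! h
    have hli := linearIndependent_monoidHom F F
    have hinj : Function.Injective
        (fun i : Fin n => (((ζ ^ (i : ℕ) : F ≃ₐ[k] F) : F →ₐ[k] F) : F →* F)) := by
      intro i j hij
      have : ζ ^ (i : ℕ) = ζ ^ (j : ℕ) := by
        ext x; exact DFunLike.congr_fun hij x
      exact Fin.ext (pow_injOn_Iio_orderOf (by simp [hord]) (by simp [hord]) this)
    have h3 := Fintype.linearIndependent_iff.1 (hli.comp _ hinj)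
      (fun i => (T^[(i : ℕ)] B) u0 v0) (by
        funext x
        have := h x
        rw [Finset.sum_range] at this
        simp only [Finset.sum_apply, Pi.smul_apply, smul_eq_mul, Pi.zero_apply]
        rw [← this]
        exact Finset.sum_congr rfl fun i _ => mul_comm _ _)
    exact hB0 (by simpa using h3 ⟨0, hn⟩)
  let B1 : S → S → F := fun u v => f * B u v
  have hB1 : SymBil B1 := by
    refine ⟨fun u u' v => ?_, fun a u v => ?_, fun u v => ?_⟩
    · simp only [B1, hB.1]; ring
    · simp only [B1, hB.2.1]; ring
    · simp only [B1, hB.2.2 u v]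
  have hB1n : T^[n] B1 = B1 := hTn B1 hB1 (fun u v => by simp only [B1, hBsa])
  have hsym : ∀ i, SymBil (T^[i] B1) := by
    intro i
    induction i with
    | zero => exact hB1
    | succ i ih =>
      rw [Function.iterate_succ_apply']
      exact symBil_Tw ζ c _ hτadd hτsm _ ih
  refine ⟨fun u v => ∑ i ∈ Finset.range n, (T^[i] B1) u v, ⟨?_, ?_, ?_⟩, ?_, u0, v0, ?_⟩
  · intro u u' v
    rw [← Finset.sum_add_distrib]
    exact Finset.sum_congr rfl fun i _ => (hsym i).1 u u' v
  · intro a u v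
    rw [Finset.mul_sum]
    exact Finset.sum_congr rfl fun i _ => (hsym i).2.1 a u v
  · intro u v
    exact Finset.sum_congr rfl fun i _ => (hsym i).2.2 u v
  · intro u v
    have e1 : ∑ i ∈ Finset.range n, (T^[i + 1] B1) (θS u) (θS v) =
        c * ζ (∑ i ∈ Finset.range n, (T^[i] B1) u v) := by
      rw [map_sum, Finset.mul_sum]
      refine Finset.sum_congr rfl fun i _ => ?_
      rw [Function.iterate_succ_apply', hT]
    rw [← e1]
    have e2 := Finset.sum_range_succ (fun i => (T^[i] B1) (θS u) (θS v)) n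
    have e3 := Finset.sum_range_succ' (fun i => (T^[i] B1) (θS u) (θS v)) n
    rw [e2] at e3
    simp only [hB1n, Function.iterate_zero, id] at e3
    exact add_right_cancel e3
  · simpa only [B1, hTf] using hf

end helpers

/-- Let `S` be a simple `A_β`-module with `i = i^⋆` (i.e. nonzero
admissible pairings `S × S → F` exist).  If every admissible pairing on `S` is
skew-Hermitian, then the endomorphism algebra `D_i = End_{A_β}(S)^{opp}` is commutative
(`D_i = L_i`), the involution `σ_c` restricts to the identity on `L_i` (equivalently
`σ|_k = id` and `b_i² = Nm_{F/k}(c)`, i.e. `θ^{2n} = Nm_{F/k}(c)·id` on `S`), and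
`σ ≠ id_F`. -/
theorem skew_hermitian_case
    {k F S : Type*} [Field k] [Field F] [Algebra k F]
    [FiniteDimensional k F] [IsGalois k F]
    (hch : (2 : k) ≠ 0)
    (ζ : F ≃ₐ[k] F) (n m : ℕ) (hn : 0 < n) (hord : orderOf ζ = n)
    (hdeg : Module.finrank k F = n)
    (hgen : ∀ g : F ≃ₐ[k] F, g ∈ Subgroup.zpowers ζ)
    (hnm : n ∣ m)
    (β : k) (hβ : β ≠ 0)
    (σ : F ≃+* F) (hσinv : ∀ a, σ (σ a) = a) (hσζ : ∀ a, σ (ζ a) = ζ (σ a))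
    (c : F) (hc : c ≠ 0) (hcσ : σ c = c)
    (hnormc : algebraMap k F (Algebra.norm k c ^ (m / n)) =
      algebraMap k F β * σ (algebraMap k F β))
    [AddCommGroup S] [Module F S] [FiniteDimensional F S] [Nontrivial S]
    (θS : S → S)
    (haddS : ∀ u v, θS (u + v) = θS u + θS v)
    (hsemiS : ∀ (a : F) (u : S), θS (a • u) = ζ a • θS u)
    (hbijS : Function.Bijective θS)
    (hθSm : ∀ u, θS^[m] u = algebraMap k F β • u)
    (hsimpS : ∀ W : Submodule F S, (∀ w ∈ W, θS w ∈ W) → W = ⊥ ∨ W = ⊤)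
    (hex : ∃ B : S → S → F, IsAdmissiblePairing (⇑ζ) (⇑σ) c θS B ∧ B ≠ 0)
    (hskew : ∀ B : S → S → F, IsAdmissiblePairing (⇑ζ) (⇑σ) c θS B →
      ∀ u v, B v u = - σ (B u v)) :
    (∀ d e : S →ₗ[F] S, (∀ s, d (θS s) = θS (d s)) → (∀ s, e (θS s) = θS (e s)) →
      d ∘ₗ e = e ∘ₗ d) ∧
    (∀ x : k, σ (algebraMap k F x) = algebraMap k F x) ∧
    (∀ s : S, θS^[2 * n] s = algebraMap k F (Algebra.norm k c) • s) ∧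
    (∃ a : F, σ a ≠ a) := by
  obtain ⟨B, hB, hB0⟩ := hex
  have hBs := hskew B hB
  obtain ⟨b1, b2, b3, b4, b5⟩ := hB
  -- nondegeneracy on the left
  have hB0z : ∀ v, B 0 v = 0 := fun v => by simpa using b2 0 0 v
  have hnd : ∀ u, (∀ v, B u v = 0) → u = 0 := by
    let W : Submodule F S :=
      { carrier := {u | ∀ v, B u v = 0}
        add_mem' := fun {x y} hx hy v => by rw [b1, hx v, hy v, add_zero]
        zero_mem' := hB0z
        smul_mem' := fun a x hx v => by rw [b2, hx v, mul_zero] }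
    have hW : ∀ w ∈ W, θS w ∈ W := by
      intro w hw v
      obtain ⟨v, rfl⟩ := hbijS.surjective v
      rw [b5, hw v, map_zero, mul_zero]
    rcases hsimpS W hW with h | h
    · intro u hu
      have : u ∈ W := hu
      rw [h] at this
      simpa using this
    · exfalso
      apply hB0
      funext u v
      have : u ∈ W := h ▸ Submodule.mem_top
      exact this v
  have hsub : ∀ x y v, B (x - y) v = B x v - B y v := by
    intro x y v
    have := b1 (x - y) y v
    rw [sub_add_cancel] at this
    rw [this]; ring
  have hext : ∀ x y, (∀ v, B x v = B y v) → x = y := by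
    intro x y h
    exact sub_eq_zero.1 (hnd _ fun v => by rw [hsub, h, sub_self])
  have hadj : ∀ d : S → S, (∀ u v, d (u + v) = d u + d v) → (∀ (a : F) u, d (a • u) = a • d u) →
      (∀ s, d (θS s) = θS (d s)) → ∀ u v, B (d u) v = B u (d v) := by
    intro d hd1 hd2 hd3 u v
    have h := hskew (fun u v => B (d u) v)
      ⟨fun u u' v => by simp only [hd1, b1], fun a u v => by simp only [hd2, b2],
        fun u v v' => b3 _ _ _, fun a u v => b4 _ _ _, fun u v => by simp only [hd3, b5]⟩ v u
    rw [h, ← hBs (d v) u]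
  have hζn : ζ ^ n = 1 := hord ▸ pow_orderOf_eq_one ζ
  have hP := norm_cyclic ζ hgen c
  rw [hord] at hP
  have hbb : ∀ s, θS^[n] (θS^[n] s) = algebraMap k F (Algebra.norm k c) • s := by
    intro s
    apply hext
    intro v
    rw [hadj (θS^[n]) (iter_add θS haddS n)
      (fun a u => by rw [iter_smul ζ θS hsemiS, hζn]; rfl)
      (fun s => by rw [← Function.iterate_succ_apply, Function.iterate_succ_apply'])]
    rw [iter_pair ζ c θS B b5, hζn, b2, hP]; rfl
  refine ⟨?_, ?_, ?_, ?_⟩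
  · intro d e hd he
    ext s
    have ad := hadj d d.map_add d.map_smul hd
    have ae := hadj e e.map_add e.map_smul he
    have ade := hadj (d ∘ₗ e) (d ∘ₗ e).map_add (d ∘ₗ e).map_smul
      (fun s => by simp [hd, he])
    apply hext
    intro v
    rw [ade]
    simp only [LinearMap.comp_apply]
    rw [← ad, ← ae]
  · intro x
    obtain ⟨u, v, huv⟩ : ∃ u v, B u v ≠ 0 := by
      by_contra! h
      exact hB0 (by funext u v; exact h u v)
    have h := hadj (fun s => algebraMap k F x • s) (fun u v => smul_add _ _ _)
      (fun a u => smul_comm _ _ _) (fun s => by rw [hsemiS, ζ.commutes]) u v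
    simp only [b2, b4] at h
    exact (mul_right_cancel₀ huv h).symm
  · intro s
    rw [two_mul, Function.iterate_add_apply, hbb]
  · by_contra! hσ
    have h2 : (2 : F) ≠ 0 := by
      have := (map_ne_zero (algebraMap k F)).2 hch
      rwa [map_ofNat] at this
    obtain ⟨C, hC, hC5, u, v, huv⟩ := exists_sym_admissible ζ n hn hord c hc h2 θS haddS hsemiS
      hbijS (fun s => by rw [hbb, hP])
    have h := hskew C ⟨hC.1, hC.2.1,
      fun u v v' => by rw [hC.2.2, hC.1, hC.2.2 v, hC.2.2 v'],
      fun a u v => by rw [hC.2.2, hC.2.1, hσ, hC.2.2 v], hC5⟩ u v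
    rw [hσ, hC.2.2 v u] at h
    have h3 : 2 * C u v = 0 := by linear_combination h
    exact (mul_ne_zero h2 huv) h3
end

section
/- Suppose every A_β-module homomorphism η: S_i^ξ → S_{i^⋆} is skew-self-adjoint (⟨u, η(v)⟩_i = −σ⟨v, η(u)⟩_i for all u,v) and Hom_{A_β}(S_i^ξ, S_{i^⋆}) ≠ 0. Then D_i = L_i, the automorphism σ_{cξ^{-1}}: b ↦ Nm_{F/k}(cξ^{-1})b^{-1} restricts to the identity on L_i, and σ ≠ id_F. -/
/-- A pairing `B : S × S' → F` is *admissible* if it is `F`-linear in the first variable,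
`(F,σ)`-semilinear in the second, and satisfies `B(θ u, θ' v) = c·ζ(B(u,v))`. -/
def IsAdmissiblePairing₂ {F S S' : Type*} [Field F]
    [AddCommGroup S] [Module F S] [AddCommGroup S'] [Module F S']
    (ζ σ : F → F) (c : F) (θS : S → S) (θS' : S' → S') (B : S → S' → F) : Prop :=
  (∀ u u' v, B (u + u') v = B u v + B u' v) ∧
  (∀ (a : F) (u v), B (a • u) v = a * B u v) ∧
  (∀ u v v', B u (v + v') = B u v + B u v') ∧
  (∀ (a : F) (u v), B u (a • v) = σ a * B u v) ∧
  (∀ u v, B (θS u) (θS' v) = c * ζ (B u v))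

/-- Let `e : i → ξ̄(i) = i^⋆` be an arrow of `Q_ξ` fixed by the duality
involution, `S = S_i`, `S' = S_{i^⋆}` simple `A_β`-modules with a perfect admissible pairing
`⟨·,·⟩_i = B : S × S' → F`, and `ξ ∈ (F^σ)^×` with `Nm_{F/k}(ξ) ∈ μ_{m/n}(k)`.
An `A_β`-homomorphism `η : S^ξ → S'` is an `F`-linear map with `η(ξ·θ(u)) = θ'(η(u))`.
Suppose `Hom_{A_β}(S^ξ, S') ≠ 0` and every such `η` is skew-self-adjoint
(`⟨u, η(v)⟩_i = -σ⟨v, η(u)⟩_i`).  Then `D_i = L_i` (the commutant of `θS` is commutative),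
`σ_{cξ^{-1}}` restricts to the identity on `L_i` (equivalently `σ|_k = id` and
`b_i² = Nm_{F/k}(cξ^{-1})`, i.e. `θ^{2n} = Nm_{F/k}(c)·Nm_{F/k}(ξ)^{-1}·id` on `S`), and
`σ ≠ id_F`. -/
theorem twisted_skew_self_adjoint_case
    {k F S S' : Type*} [Field k] [Field F] [Algebra k F]
    [FiniteDimensional k F] [IsGalois k F]
    (hch : (2 : k) ≠ 0)
    (ζ : F ≃ₐ[k] F) (n m : ℕ) (hn : 0 < n) (hord : orderOf ζ = n)
    (hdeg : Module.finrank k F = n)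
    (hgen : ∀ g : F ≃ₐ[k] F, g ∈ Subgroup.zpowers ζ)
    (hnm : n ∣ m)
    (β : k) (hβ : β ≠ 0)
    (σ : F ≃+* F) (hσinv : ∀ a, σ (σ a) = a) (hσζ : ∀ a, σ (ζ a) = ζ (σ a))
    (c : F) (hc : c ≠ 0) (hcσ : σ c = c)
    (ξ : F) (hξ : ξ ≠ 0) (hσξ : σ ξ = ξ)
    (hnormξ : Algebra.norm k ξ ^ (m / n) = 1)
    [AddCommGroup S] [Module F S] [FiniteDimensional F S] [Nontrivial S]
    [AddCommGroup S'] [Module F S'] [FiniteDimensional F S'] [Nontrivial S']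
    (θS : S → S) (θS' : S' → S')
    (haddS : ∀ u v, θS (u + v) = θS u + θS v)
    (hsemiS : ∀ (a : F) (u : S), θS (a • u) = ζ a • θS u)
    (hbijS : Function.Bijective θS)
    (hθSm : ∀ u, θS^[m] u = algebraMap k F β • u)
    (hsimpS : ∀ W : Submodule F S, (∀ w ∈ W, θS w ∈ W) → W = ⊥ ∨ W = ⊤)
    (haddS' : ∀ u v, θS' (u + v) = θS' u + θS' v)
    (hsemiS' : ∀ (a : F) (u : S'), θS' (a • u) = ζ a • θS' u)
    (hbijS' : Function.Bijective θS')
    (hθS'm : ∀ u, θS'^[m] u = algebraMap k F β • u)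
    (hsimpS' : ∀ W : Submodule F S', (∀ w ∈ W, θS' w ∈ W) → W = ⊥ ∨ W = ⊤)
    (B : S → S' → F)
    (hB : IsAdmissiblePairing₂ (⇑ζ) (⇑σ) c θS θS' B)
    (hBl : ∀ u, (∀ v, B u v = 0) → u = 0)
    (hBr : ∀ v, (∀ u, B u v = 0) → v = 0)
    (hex : ∃ η : S →ₗ[F] S', (∀ u, η (ξ • θS u) = θS' (η u)) ∧ η ≠ 0)
    (hskew : ∀ η : S →ₗ[F] S', (∀ u, η (ξ • θS u) = θS' (η u)) →
      ∀ u v, B u (η v) = - σ (B v (η u))) :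
    (∀ d e : S →ₗ[F] S, (∀ s, d (θS s) = θS (d s)) → (∀ s, e (θS s) = θS (e s)) →
      d ∘ₗ e = e ∘ₗ d) ∧
    (∀ x : k, σ (algebraMap k F x) = algebraMap k F x) ∧
    (∀ s : S, θS^[2 * n] s =
      algebraMap k F (Algebra.norm k c * (Algebra.norm k ξ)⁻¹) • s) ∧
    (∃ a : F, σ a ≠ a) := by
  classical
  obtain ⟨hBa, hBs, hBa2, hBs2, hBθ⟩ := hB
  obtain ⟨η, hη, hη0⟩ := hex
  -- surjectivity of η
  have hηsurj : ∀ w, ∃ v, η v = w := by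
    rcases hsimpS' (LinearMap.range η) (by
      rintro w ⟨v, rfl⟩
      exact ⟨ξ • θS v, hη v⟩) with h | h
    · exact absurd (LinearMap.range_eq_bot.mp h) hη0
    · intro w
      exact LinearMap.range_eq_top.mp h w
  have hηinj : ∀ v, η v = 0 → v = 0 := by
    rcases hsimpS (LinearMap.ker η) (by
      intro v hv
      have h1 := hη v
      rw [LinearMap.mem_ker] at hv ⊢
      have h0 : θS' 0 = 0 := by simpa using haddS' 0 0
      rw [hv, h0, map_smul] at h1
      exact (smul_eq_zero.mp h1).resolve_left hξ) with h | h
    · intro v hv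
      have : v ∈ LinearMap.ker η := hv
      rw [h] at this
      simpa using this
    · exact absurd (LinearMap.ker_eq_top.mp h) hη0
  -- the form
  obtain ⟨h, hh⟩ : ∃ h : S → S → F, ∀ u v, h u v = B u (η v) := ⟨_, fun _ _ => rfl⟩
  have ha : ∀ u u' v, h (u + u') v = h u v + h u' v := by intros; simp only [hh, hBa]
  have hs : ∀ (a : F) (u v), h (a • u) v = a * h u v := by intros; simp only [hh, hBs]
  have ha2 : ∀ u v v', h u (v + v') = h u v + h u v' := by
    intros; simp only [hh, map_add, hBa2]
  have hs2 : ∀ (a : F) (u v), h u (a • v) = σ a * h u v := by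
    intros; simp only [hh, map_smul, hBs2]
  have hsk : ∀ u v, h u v = - σ (h v u) := by
    intro u v; simp only [hh]; exact hskew η hη u v
  have hnl : ∀ u, (∀ v, h u v = 0) → u = 0 := by
    intro u hu
    apply hBl
    intro w
    obtain ⟨v, rfl⟩ := hηsurj w
    rw [← hh]; exact hu v
  have hnr : ∀ v, (∀ u, h u v = 0) → v = 0 := by
    intro v hv
    apply hηinj
    apply hBr
    intro u
    rw [← hh]; exact hv u
  have hθ : ∀ u v, h (θS u) (θS v) = (c * ξ⁻¹) * ζ (h u v) := by
    intro u v
    have h1 := hBθ u (η v)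
    rw [← hη, ← hh, ← hh, hs2, hσξ] at h1
    field_simp
    linear_combination h1
  have hD : ∀ d : S →ₗ[F] S, (∀ s, d (θS s) = θS (d s)) → ∀ u v, h (d u) v = h u (d v) := by
    intro d hd u v
    have h1 := hskew (η ∘ₗ d) (by
      intro u
      simp only [LinearMap.comp_apply, map_smul, hd]
      rw [← map_smul, hη]) u v
    simp only [LinearMap.comp_apply, ← hh] at h1
    rw [h1, hsk]
  have hsubl : ∀ u u' v, h (u - u') v = h u v - h u' v := by
    intro u u' v
    have := ha (u - u') u' v
    rw [sub_add_cancel] at this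
    rw [this]; ring
  have hsubr : ∀ u v v', h u (v - v') = h u v - h u v' := by
    intro u v v'
    have := ha2 u (v - v') v'
    rw [sub_add_cancel] at this
    rw [this]; ring
  have hζn : ζ ^ n = 1 := by rw [← hord]; exact pow_orderOf_eq_one ζ
  have hadd : ∀ (j : ℕ) u v, θS^[j] (u + v) = θS^[j] u + θS^[j] v := by
    intro j
    induction j with
    | zero => intros; rfl
    | succ j ih => intro u v; simp only [Function.iterate_succ_apply', ih, haddS]
  have hsem : ∀ (j : ℕ) (a : F) u, θS^[j] (a • u) = (ζ ^ j) a • θS^[j] u := by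
    intro j
    induction j with
    | zero => intros; simp
    | succ j ih =>
      intro a u
      simp only [Function.iterate_succ_apply', ih, hsemiS, pow_succ', AlgEquiv.mul_apply]
  obtain ⟨b, hb⟩ : ∃ b : S →ₗ[F] S, ∀ s, b s = θS^[n] s :=
    ⟨{ toFun := θS^[n], map_add' := hadd n, map_smul' := by
        intro a u
        rw [hsem, hζn]; rfl }, fun _ => rfl⟩
  have hbθ : ∀ s, b (θS s) = θS (b s) := by
    intro s
    rw [hb, hb, ← Function.iterate_succ_apply, Function.iterate_succ_apply']
  have hbsa := hD b hbθ
  have hk : ∀ x : k, σ (algebraMap k F x) = algebraMap k F x := by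
    intro x
    obtain ⟨u, hu⟩ := exists_ne (0 : S)
    obtain ⟨v, hv⟩ : ∃ v, h u v ≠ 0 := by
      by_contra hcon
      push Not at hcon
      exact hu (hnl u hcon)
    have h1 := hD (algebraMap k F x • LinearMap.id) (by
      intro s
      simp [hsemiS]) u v
    simp only [LinearMap.smul_apply, LinearMap.id_apply, hs, hs2] at h1
    exact (mul_right_cancel₀ hv h1).symm
  obtain ⟨N, hN⟩ : ∃ N, N = algebraMap k F (Algebra.norm k c * (Algebra.norm k ξ)⁻¹) := ⟨_, rfl⟩
  have hNprod : ∏ i ∈ Finset.range n, (ζ ^ i) (c * ξ⁻¹) = N := by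
    have h1 : Algebra.norm k c * (Algebra.norm k ξ)⁻¹ = Algebra.norm k (c * ξ⁻¹) := by
      rw [map_mul]
      congr 1
      apply inv_eq_of_mul_eq_one_right
      rw [← map_mul, mul_inv_cancel₀ hξ, map_one]
    rw [hN, h1, Algebra.norm_eq_prod_automorphisms]
    refine Finset.prod_bij (fun i _ => ζ ^ i) (fun _ _ => Finset.mem_univ _) ?_ ?_ ?_
    · intro i hi j hj hij
      refine pow_injOn_Iio_orderOf ?_ ?_ hij
      · rw [hord]; exact Finset.mem_range.mp hi
      · rw [hord]; exact Finset.mem_range.mp hj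
    · intro g _
      obtain ⟨i, hi, hg⟩ := (mem_zpowers_iff_mem_range_orderOf.mp (hgen g)) |> Finset.mem_image.mp
      exact ⟨i, by rwa [hord] at hi, hg⟩
    · intros; rfl
  have hθj : ∀ (j : ℕ) u v, h (θS^[j] u) (θS^[j] v) =
      (∏ i ∈ Finset.range j, (ζ ^ i) (c * ξ⁻¹)) * (ζ ^ j) (h u v) := by
    intro j
    induction j with
    | zero => intros; simp
    | succ j ih =>
      intro u v
      rw [Function.iterate_succ_apply', Function.iterate_succ_apply', hθ, ih, map_mul, map_prod,
        Finset.prod_range_succ']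
      simp only [pow_succ', AlgEquiv.mul_apply, pow_zero, AlgEquiv.one_apply]
      ring
  have hbN : ∀ s, b (b s) = N • s := by
    intro s
    rw [← sub_eq_zero]
    apply hnr
    intro u
    have hσN : σ N = N := by rw [hN]; exact hk _
    rw [hsubr, ← hbsa, hb, hb, hθj, hNprod, hζn, hs2, hσN]
    simp
  refine ⟨?_, hk, ?_, ?_⟩
  · intro d e hd he
    ext v
    simp only [LinearMap.comp_apply]
    rw [← sub_eq_zero]
    apply hnr
    intro u
    have h1 := hD (d ∘ₗ e) (by intro s; simp [hd, he]) u v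
    simp only [LinearMap.comp_apply] at h1
    rw [hsubr, ← h1, hD d hd, hD e he, sub_self]
  · intro s
    rw [two_mul, Function.iterate_add_apply, ← hb, ← hb, hbN, hN]
  · by_contra hcon
    push Not at hcon
    simp only [hcon] at hsk hs2
    have h2F : (2 : F) ≠ 0 := by
      intro h0
      apply hch
      apply (algebraMap k F).injective
      rw [map_ofNat, map_zero]
      exact h0
    have hbinj : ∀ s, b s = 0 → s = 0 := by
      intro s hs0
      have h0 : θS^[n] 0 = 0 := by simpa using hadd n 0 0
      rw [hb, ← h0] at hs0
      exact hbijS.injective.iterate n hs0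
    -- descent: everything commuting with b is self-adjoint (after composing with b)
    have key : ∀ T : S →ₗ[F] S, (∀ s, T (b s) = b (T s)) →
        ∀ x y, h (T (b x)) y = h x (T (b y)) := by
      intro T hT x y
      have hE : ∀ a : F, ∑ i ∈ Finset.range n, (ζ ^ i) a *
          (h (θS^[i] (T (θS^[n - i] x))) y - h x (θS^[i] (T (θS^[n - i] y)))) = 0 := by
        intro a
        obtain ⟨E, hEd⟩ : ∃ E : S →ₗ[F] S, ∀ s, E s =
            ∑ i ∈ Finset.range n, (ζ ^ i) a • θS^[i] (T (θS^[n - i] s)) :=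
          ⟨{ toFun := fun s => ∑ i ∈ Finset.range n, (ζ ^ i) a • θS^[i] (T (θS^[n - i] s))
             map_add' := by
              intro s t
              simp only [hadd, map_add, smul_add, Finset.sum_add_distrib]
             map_smul' := by
              intro f s
              rw [RingHom.id_apply, Finset.smul_sum]
              apply Finset.sum_congr rfl
              intro i hi
              have hi' : i + (n - i) = n := by
                have := Finset.mem_range.mp hi
                omega
              rw [hsem, map_smul, hsem, ← AlgEquiv.mul_apply, ← pow_add, hi', hζn,
                AlgEquiv.one_apply, smul_comm] }, fun _ => rfl⟩
        have hEθ : ∀ s, E (θS s) = θS (E s) := by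
          intro s
          let θA : S →+ S := AddMonoidHom.mk' θS haddS
          have hθA : ∀ s, θS s = θA s := fun _ => rfl
          have h1 : θS (E s) = ∑ i ∈ Finset.range n,
              (ζ ^ (i+1)) a • θS^[i+1] (T (θS^[n + 1 - (i+1)] s)) := by
            rw [hEd, hθA, map_sum]
            apply Finset.sum_congr rfl
            intro i hi
            rw [← hθA, hsemiS, ← Function.iterate_succ_apply' θS, pow_succ', AlgEquiv.mul_apply,
              Nat.add_sub_add_right]
          have h2 : E (θS s) = ∑ i ∈ Finset.range n,
              (ζ ^ i) a • θS^[i] (T (θS^[n + 1 - i] s)) := by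
            rw [hEd]
            apply Finset.sum_congr rfl
            intro i hi
            have := Finset.mem_range.mp hi
            rw [← Function.iterate_succ_apply, Nat.succ_eq_add_one,
              show n - i + 1 = n + 1 - i by omega]
          have h3 := Finset.sum_range_succ
            (fun i => (ζ ^ i) a • θS^[i] (T (θS^[n + 1 - i] s))) n
          have h4 := Finset.sum_range_succ'
            (fun i => (ζ ^ i) a • θS^[i] (T (θS^[n + 1 - i] s))) n
          rw [h1, h2]
          rw [h3] at h4
          have h5 : (ζ ^ n) a • θS^[n] (T (θS^[n + 1 - n] s)) =
              (ζ ^ 0) a • θS^[0] (T (θS^[n + 1 - 0] s)) := by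
            rw [hζn, pow_zero, Nat.add_sub_cancel_left, Nat.sub_zero, Function.iterate_zero,
              Function.iterate_one, id, Function.iterate_succ_apply, ← hb, ← hb, hT]
          rw [h5] at h4
          exact add_right_cancel h4
        have h1 := hD E hEθ x y
        let hl : S →+ F := AddMonoidHom.mk' (fun u => h u y) (fun u u' => ha u u' y)
        let hr : S →+ F := AddMonoidHom.mk' (fun u => h x u) (ha2 x)
        have h2 : h (E x) y = ∑ i ∈ Finset.range n, (ζ ^ i) a *
            h (θS^[i] (T (θS^[n - i] x))) y := by
          change hl (E x) = _
          rw [hEd, map_sum]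
          exact Finset.sum_congr rfl fun i _ => hs _ _ _
        have h3 : h x (E y) = ∑ i ∈ Finset.range n, (ζ ^ i) a *
            h x (θS^[i] (T (θS^[n - i] y))) := by
          change hr (E y) = _
          rw [hEd, map_sum]
          exact Finset.sum_congr rfl fun i _ => hs2 _ _ _
        simp only [mul_sub, Finset.sum_sub_distrib]
        rw [← h2, ← h3, h1, sub_self]
      have hli := (linearIndependent_monoidHom F F).comp
        (fun i : Fin n => ((ζ ^ (i : ℕ) : F ≃ₐ[k] F) : F →* F)) (by
          intro i j hij
          have h1 : ζ ^ (i : ℕ) = ζ ^ (j : ℕ) := by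
            ext a
            exact DFunLike.congr_fun hij a
          apply Fin.ext
          refine pow_injOn_Iio_orderOf ?_ ?_ h1
          · rw [hord]; exact i.2
          · rw [hord]; exact j.2)
      rw [Fintype.linearIndependent_iff] at hli
      have h0 := hli (fun i : Fin n =>
        h (θS^[(i : ℕ)] (T (θS^[n - i] x))) y - h x (θS^[(i : ℕ)] (T (θS^[n - i] y)))) (by
          funext a
          have h1 := hE a
          rw [Finset.sum_range] at h1
          rw [Finset.sum_apply, Pi.zero_apply, ← h1]
          apply Finset.sum_congr rfl
          intro i _
          exact mul_comm _ _) ⟨0, hn⟩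
      simp only [Function.iterate_zero, id, Nat.sub_zero, ← hb] at h0
      exact sub_eq_zero.mp h0
    obtain ⟨u, hu⟩ := exists_ne (0 : S)
    obtain ⟨x, hx⟩ : ∃ x, h x u ≠ 0 := by
      by_contra hcon
      push Not at hcon
      exact hu (hnr u hcon)
    obtain ⟨T, hT⟩ : ∃ T : S →ₗ[F] S, ∀ x, T x = (N * h x u) • u + h x (b u) • b u :=
      ⟨{ toFun := fun x => (N * h x u) • u + h x (b u) • b u
         map_add' := by intro s t; simp only [ha]; module
         map_smul' := by intro f s; simp only [hs, RingHom.id_apply]; module }, fun _ => rfl⟩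
    have hTb : ∀ s, T (b s) = (N * h s (b u)) • u + (N * h s u) • b u := by
      intro s
      rw [hT, hbsa, hbsa, hbN, hs2]
    have hTc : ∀ s, T (b s) = b (T s) := by
      intro s
      rw [hTb, hT, map_add, map_smul, map_smul, hbN]
      module
    have hT0 : T (b x) = 0 := by
      apply hnl
      intro y
      have h1 := key T hTc x y
      have h2 : h (T (b x)) y = - h x (T (b y)) := by
        rw [hTb, hTb, ha, ha2, hs, hs, hs2, hs2, hsk y (b u), hsk y u]
        ring
      have h3 : 2 * h (T (b x)) y = 0 := by linear_combination h1 + h2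
      exact (mul_eq_zero.mp h3).resolve_left h2F
    have hbx : N • (h x (b u) • u + h x u • b u) = 0 := by
      rw [← hT0, hTb]; module
    have hN0 : N ≠ 0 := by
      intro h0
      apply hu
      apply hbinj
      apply hbinj
      rw [hbN, h0, zero_smul]
    have h1 := (smul_eq_zero.mp hbx).resolve_left hN0
    have h2 : b u = (-(h x (b u)) / h x u) • u := by
      have h3 : h x u • b u = (-(h x (b u))) • u := by
        rw [neg_smul]; exact eq_neg_of_add_eq_zero_right h1
      rw [div_eq_inv_mul, mul_smul, ← h3, smul_smul, inv_mul_cancel₀ hx, one_smul]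
    obtain ⟨l, hl⟩ : ∃ l : F, b u = l • u := ⟨_, h2⟩
    rw [hl, hs2, smul_smul, ← add_smul] at h1
    have h4 := (smul_eq_zero.mp h1).resolve_right hu
    have h5 : (2 * h x u) * l = 0 := by linear_combination h4
    have h6 := (mul_eq_zero.mp h5).resolve_left (mul_ne_zero h2F hx)
    apply hu
    apply hbinj
    rw [hl, h6, zero_smul]
end
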